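/- (Multi-Level ROSS, subsampling) Let {g_i, h_i}_{i∈{0,1}} be a perfect reconstruction filterbank with finitely supported filters that satisfies the analysis–synthesis symmetry with parameters (a,b). Then for every number of levels L ≥ 1, every bit vector 𝐢 ∈ {0,1}^L with level-0 bit i_0, every x : ℤ → ℝ, and every n ∈ ℤ: v^{x_s}_𝐢[n] = (−1)^{i_0}·w^{x_s}_{𝐢′}[n] and v^{x_s}_𝐢[n] = (1/2)·(v^x_𝐢[n] + (−1)^{i_0}·w^x_{𝐢′}[n]). -/

import Mathlib

open scoped BigOperators

noncomputable section

/-- Discrete convolution `(f ⋆ x)[n] = Σ_m f[m]·x[n−m]` (a finite sum when `f` is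
finitely supported). -/
def conv (f x : ℤ → ℝ) (n : ℤ) : ℝ := ∑ᶠ m : ℤ, f m * x (n - m)

/-- One-level filterbank coefficient `v^x_i[n] = (g_i ⋆ x)[2n]`. -/
def fbCoeff (g x : ℤ → ℝ) (n : ℤ) : ℝ := conv g x (2 * n)

/-- Perfect reconstruction filterbank:
`x[n] = Σ_{i∈{0,1}} Σ_m h_i[n−2m]·v^x_i[m]` for all `x` and `n`. -/
def IsPR (g h : ZMod 2 → ℤ → ℝ) : Prop :=
  ∀ (x : ℤ → ℝ) (n : ℤ),
    x n = ∑ i : ZMod 2, ∑ᶠ m : ℤ, h i (n - 2 * m) * fbCoeff (g i) x m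

/-- Discrete-time Fourier transform `f̂(ω) = Σ_n f[n]·exp(−i·n·ω)`. -/
def dtft (f : ℤ → ℝ) (ω : ℝ) : ℂ :=
  ∑ᶠ n : ℤ, (f n : ℂ) * Complex.exp (-(Complex.I * (n : ℂ) * (ω : ℂ)))

/-- Analysis–synthesis symmetry with parameters `(a, b)`:
`ĝ_i(ω) = (−1)^{1−i}·a·exp(i(2b+1)ω)·ĥ_{1−i}(ω−π)`. -/
def SymmAS (g h : ZMod 2 → ℤ → ℝ) (a : ℝ) (b : ℤ) : Prop :=
  ∀ (i : ZMod 2) (ω : ℝ),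
    dtft (g i) ω
      = (-1 : ℂ) ^ (1 - i : ZMod 2).val * (a : ℂ)
        * Complex.exp (Complex.I * (2 * (b : ℂ) + 1) * (ω : ℂ))
        * dtft (h (1 - i)) (ω - Real.pi)

/-- Complementary analysis filter `g̃_i[n] = a·h_i[n + 2b + 1]`. -/
def compG (a : ℝ) (b : ℤ) (h : ℤ → ℝ) (n : ℤ) : ℝ := a * h (n + (2 * b + 1))

/-- Complementary synthesis filter `h̃_i[n] = a⁻¹·g_i[n − (2b + 1)]`. -/
def compH (a : ℝ) (b : ℤ) (g : ℤ → ℝ) (n : ℤ) : ℝ := a⁻¹ * g (n - (2 * b + 1))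

/-- Modulated sequence `x_m[n] = (−1)^n·x[n]`. -/
def modSeq (x : ℤ → ℝ) (n : ℤ) : ℝ := (-1 : ℝ) ^ n * x n

/-- Subsampled sequence: `x_s[n] = x[n]` for even `n`, and `0` for odd `n`. -/
def subSeq (x : ℤ → ℝ) (n : ℤ) : ℝ := if Even n then x n else 0

/-- Haar analysis filters: `g_i[0] = 1`, `g_i[−1] = (−1)^i`, else `0`. -/
def haarG (i : ZMod 2) (n : ℤ) : ℝ :=
  if n = 0 then 1 else if n = -1 then (-1 : ℝ) ^ i.val else 0

/-- Haar synthesis filters: `h_i[0] = 1/2`, `h_i[1] = (−1)^i/2`, else `0`. -/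
def haarH (i : ZMod 2) (n : ℤ) : ℝ :=
  if n = 0 then 1 / 2 else if n = 1 then (-1 : ℝ) ^ i.val / 2 else 0

/-- `L`-level filterbank coefficients `v^x_𝐢`; the bit `𝐢 0` is the level-0 bit,
applied first, then the remaining levels recursively. -/
def mCoeff (g : ZMod 2 → ℤ → ℝ) : (L : ℕ) → (Fin L → ZMod 2) → (ℤ → ℝ) → ℤ → ℝ
  | 0, _, x => x
  | L + 1, i, x => mCoeff g L (fun t => i t.succ) (fbCoeff (g (i 0)) x)

/-- `L`-level complementary coefficients `w^x_𝐢`: identical to `mCoeff` except that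
the level-0 filter is taken from the complementary bank `gt`. -/
def mCoeffW (g gt : ZMod 2 → ℤ → ℝ) : (L : ℕ) → (Fin L → ZMod 2) → (ℤ → ℝ) → ℤ → ℝ
  | 0, _, x => x
  | L + 1, i, x => mCoeff g L (fun t => i t.succ) (fbCoeff (gt (i 0)) x)

/-- `𝐢′`: flip the level-0 bit of `𝐢`. -/
def flip0 {L : ℕ} (i : Fin (L + 1) → ZMod 2) : Fin (L + 1) → ZMod 2 :=
  Function.update i 0 (1 - i 0)

/-- The character `ω ↦ exp(−i·n·ω)` of the additive group of `ℝ`. -/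
def dtftChar (n : ℤ) : Multiplicative ℝ →* ℂ where
  toFun ω := Complex.exp (-(Complex.I * (n : ℂ) * (ω.toAdd : ℂ)))
  map_one' := by simp
  map_mul' x y := by
    rw [← Complex.exp_add]
    congr 1
    rw [toAdd_mul]
    push_cast
    ring

theorem dtftChar_injective : Function.Injective dtftChar := by
  intro m n hmn
  have h1 := DFunLike.congr_fun hmn (Multiplicative.ofAdd (1 : ℝ))
  simp only [dtftChar, MonoidHom.coe_mk, OneHom.coe_mk, toAdd_ofAdd, Complex.ofReal_one,
    mul_one] at h1
  rw [Complex.exp_eq_exp_iff_exists_int] at h1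
  obtain ⟨k, hk⟩ := h1
  have h2 : ((n - m : ℤ) : ℝ) = k * (2 * Real.pi) := by
    have := congrArg Complex.im hk
    simp at this
    push_cast
    linarith
  by_contra hne
  have hk0 : k ≠ 0 := by
    rintro rfl
    simp only [Int.cast_zero, zero_mul, Int.cast_eq_zero] at h2
    omega
  refine irrational_pi ⟨((n - m : ℤ) : ℚ) / (2 * k), ?_⟩
  have hkR : (k : ℝ) ≠ 0 := by exact_mod_cast hk0
  push_cast at h2 ⊢
  rw [div_eq_iff (by positivity)]
  linarith

/-- A finitely supported sequence is determined by its discrete-time Fourier transform. -/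
theorem eq_of_dtft_eq {f f' : ℤ → ℝ} (hf : f.support.Finite) (hf' : f'.support.Finite)
    (h : ∀ ω, dtft f ω = dtft f' ω) : f = f' := by
  have hli : LinearIndependent ℂ (fun n : ℤ => (dtftChar n : Multiplicative ℝ → ℂ)) :=
    (linearIndependent_monoidHom (Multiplicative ℝ) ℂ).comp _ dtftChar_injective
  have hsupp : ∀ {u : ℤ → ℝ}, u.support.Finite →
      (Function.support fun n => (u n : ℂ)).Finite := fun hu =>
    hu.subset fun n hn => by simpa using hn
  have hcomb : ∀ {u : ℤ → ℝ} (hu : u.support.Finite) (ω : ℝ),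
      Finsupp.linearCombination ℂ (fun n : ℤ => (dtftChar n : Multiplicative ℝ → ℂ))
        (Finsupp.ofSupportFinite _ (hsupp hu)) (Multiplicative.ofAdd ω) = dtft u ω := by
    intro u hu ω
    rw [Finsupp.linearCombination_apply, Finsupp.sum, Finset.sum_apply, dtft,
      finsum_eq_sum_of_support_subset]
    · rfl
    · intro n hn
      simpa [Finsupp.ofSupportFinite_coe] using left_ne_zero_of_mul hn
  have heq := hli (a₁ := Finsupp.ofSupportFinite _ (hsupp hf))
    (a₂ := Finsupp.ofSupportFinite _ (hsupp hf')) (funext fun ω => by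
      rw [← ofAdd_toAdd ω, hcomb hf, hcomb hf', h])
  funext n
  exact Complex.ofReal_injective (DFunLike.congr_fun heq n)

theorem finite_support_compG (a : ℝ) (b : ℤ) {h : ℤ → ℝ} (hh : h.support.Finite) :
    (compG a b h).support.Finite :=
  (hh.preimage (add_left_injective (2 * b + 1)).injOn).subset fun _ hn =>
    right_ne_zero_of_mul hn

theorem finite_support_modSeq {x : ℤ → ℝ} (hx : x.support.Finite) :
    (modSeq x).support.Finite :=
  hx.subset fun _ hn => right_ne_zero_of_mul hn

theorem mul_finsum_of_field {ι K : Type*} [Field K] (c : K) (f : ι → K) :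
    c * ∑ᶠ i, f i = ∑ᶠ i, c * f i :=
  smul_finsum c f

theorem dtft_const_mul (c : ℝ) (f : ℤ → ℝ) (ω : ℝ) :
    dtft (fun n => c * f n) ω = c * dtft f ω := by
  simp only [dtft, Complex.ofReal_mul, mul_assoc, mul_finsum_of_field]

theorem dtft_modSeq (f : ℤ → ℝ) (ω : ℝ) : dtft (modSeq f) ω = dtft f (ω - Real.pi) := by
  refine finsum_congr fun n => ?_
  have hn : Complex.exp (-(Complex.I * n * ((ω - Real.pi : ℝ) : ℂ)))
      = (-1) ^ n * Complex.exp (-(Complex.I * n * ω)) := by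
    rw [← Complex.exp_pi_mul_I, ← Complex.exp_int_mul, ← Complex.exp_add]
    push_cast
    ring_nf
  rw [hn, modSeq]
  push_cast
  ring

theorem dtft_shift (f : ℤ → ℝ) (c : ℤ) (ω : ℝ) :
    dtft (fun n => f (n + c)) ω = Complex.exp (Complex.I * c * ω) * dtft f ω := by
  rw [dtft, dtft, mul_finsum_of_field]
  refine (finsum_congr fun n => ?_).trans (finsum_comp_equiv (Equiv.addRight c))
  rw [Equiv.coe_addRight, mul_left_comm, ← Complex.exp_add]
  push_cast
  ring_nf

/-- In the time domain the analysis–synthesis symmetry reads `g_i[n] = (−1)^(i+n)·g̃_{1−i}[n]`. -/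
theorem SymmAS.eq_modSeq_compG {g h : ZMod 2 → ℤ → ℝ} {a : ℝ} {b : ℤ}
    (hg : ∀ i, (g i).support.Finite) (hh : ∀ i, (h i).support.Finite)
    (hsym : SymmAS g h a b) (i : ZMod 2) (n : ℤ) :
    g i n = (-1) ^ i.val * modSeq (compG a b (h (1 - i))) n := by
  have hsign : (-1 : ℝ) ^ (1 - i).val = -(-1) ^ i.val := by
    obtain rfl | rfl : i = 0 ∨ i = 1 := by decide +revert
    · simp [ZMod.val_one]
    · simp [ZMod.val_one]
  have hsignC : (-1 : ℂ) ^ (1 - i).val = -(-1) ^ i.val := by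
    exact_mod_cast congrArg Complex.ofReal hsign
  have hmod : modSeq (compG a b (h (1 - i)))
      = fun n => -a * modSeq (h (1 - i)) (n + (2 * b + 1)) := by
    funext n
    have : (-1 : ℝ) ^ (n + (2 * b + 1)) = -(-1) ^ n := by
      rw [zpow_add₀ (by norm_num), Odd.neg_one_zpow ⟨b, rfl⟩, mul_neg_one]
    simp only [modSeq, compG, this]
    ring
  refine congrFun (eq_of_dtft_eq (f' := fun n => (-1) ^ i.val * _) (hg i)
    ((finite_support_modSeq (finite_support_compG a b (hh (1 - i)))).subset
      fun _ hn => right_ne_zero_of_mul hn) fun ω => ?_) n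
  rw [hsym i ω, dtft_const_mul, hmod, dtft_const_mul,
    dtft_shift (modSeq (h (1 - i))) (2 * b + 1), dtft_modSeq, hsignC]
  push_cast
  ring

theorem finite_support_conv_term {f : ℤ → ℝ} (hf : f.support.Finite) (x : ℤ → ℝ) (n : ℤ) :
    (Function.support fun m => f m * x (n - m)).Finite :=
  hf.subset fun _ hm => left_ne_zero_of_mul hm

theorem fbCoeff_add {g : ℤ → ℝ} (hg : g.support.Finite) (x y : ℤ → ℝ) :
    fbCoeff g (x + y) = fbCoeff g x + fbCoeff g y := by
  funext n
  simp only [fbCoeff, conv, Pi.add_apply, mul_add]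
  exact finsum_add_distrib (finite_support_conv_term hg x _) (finite_support_conv_term hg y _)

theorem fbCoeff_smul (g : ℤ → ℝ) (c : ℝ) (x : ℤ → ℝ) :
    fbCoeff g (c • x) = c • fbCoeff g x := by
  funext n
  simp only [fbCoeff, conv, Pi.smul_apply, smul_eq_mul, mul_finsum_of_field, mul_left_comm]

theorem mCoeff_add {g : ZMod 2 → ℤ → ℝ} (hg : ∀ i, (g i).support.Finite) (L : ℕ)
    (i : Fin L → ZMod 2) (x y : ℤ → ℝ) :
    mCoeff g L i (x + y) = mCoeff g L i x + mCoeff g L i y := by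
  induction L generalizing x y with
  | zero => rfl
  | succ L ih => simp only [mCoeff, fbCoeff_add (hg _), ih]

theorem mCoeff_smul (g : ZMod 2 → ℤ → ℝ) (L : ℕ) (i : Fin L → ZMod 2) (c : ℝ) (x : ℤ → ℝ) :
    mCoeff g L i (c • x) = c • mCoeff g L i x := by
  induction L generalizing x with
  | zero => rfl
  | succ L ih => simp only [mCoeff, fbCoeff_smul, ih]

theorem modSeq_of_even (x : ℤ → ℝ) {n : ℤ} (hn : Even n) : modSeq x n = x n := by
  rw [modSeq, hn.neg_one_zpow, one_mul]

theorem modSeq_of_not_even (x : ℤ → ℝ) {n : ℤ} (hn : ¬Even n) : modSeq x n = -x n := by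
  rw [modSeq, (Int.not_even_iff_odd.mp hn).neg_one_zpow, neg_one_mul]

theorem even_two_mul_sub_iff (n m : ℤ) : Even (2 * n - m) ↔ Even m := by
  simp [Int.even_sub]

theorem fbCoeff_modSeq_subSeq (f x : ℤ → ℝ) :
    fbCoeff (modSeq f) (subSeq x) = fbCoeff f (subSeq x) := by
  funext n
  refine finsum_congr fun m => ?_
  by_cases hm : Even m
  · rw [modSeq_of_even f hm]
  · simp [subSeq, even_two_mul_sub_iff, hm]

theorem fbCoeff_subSeq {f : ℤ → ℝ} (hf : f.support.Finite) (x : ℤ → ℝ) :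
    fbCoeff f (subSeq x) = (1 / 2 : ℝ) • (fbCoeff (modSeq f) x + fbCoeff f x) := by
  funext n
  simp only [fbCoeff, conv, Pi.smul_apply, Pi.add_apply]
  rw [← finsum_add_distrib (finite_support_conv_term (finite_support_modSeq hf) x _)
    (finite_support_conv_term hf x _), smul_finsum]
  refine finsum_congr fun m => ?_
  by_cases hm : Even m
  · simp only [modSeq_of_even f hm, subSeq, even_two_mul_sub_iff, hm, if_true, smul_eq_mul]
    ring
  · simp [modSeq_of_not_even f hm, subSeq, even_two_mul_sub_iff, hm]

theorem fbCoeff_const_mul (c : ℝ) (f x : ℤ → ℝ) :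
    fbCoeff (fun n => c * f n) x = c • fbCoeff f x := by
  funext n
  simp only [fbCoeff, conv, Pi.smul_apply, smul_eq_mul, mul_finsum_of_field, mul_assoc]

/-- Multi-level ROSS (subsampling). -/
theorem multilevel_ROSS_subsampling (g h : ZMod 2 → ℤ → ℝ)
    (hg : ∀ i : ZMod 2, (Function.support (g i)).Finite)
    (hh : ∀ i : ZMod 2, (Function.support (h i)).Finite)
    (a : ℝ) (b : ℤ) (ha : a ≠ 0)
    (hPR : IsPR g h) (hsym : SymmAS g h a b)
    (L : ℕ) (i : Fin (L + 1) → ZMod 2) (x : ℤ → ℝ) (n : ℤ) :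
    mCoeff g (L + 1) i (subSeq x) n
      = (-1 : ℝ) ^ (i 0).val
        * mCoeffW g (fun k => compG a b (h k)) (L + 1) (flip0 i) (subSeq x) n ∧
    mCoeff g (L + 1) i (subSeq x) n
      = (1 / 2) * (mCoeff g (L + 1) i x n
          + (-1 : ℝ) ^ (i 0).val
            * mCoeffW g (fun k => compG a b (h k)) (L + 1) (flip0 i) x n) := by
  set f := compG a b (h (1 - i 0))
  have hf : f.support.Finite := finite_support_compG a b (hh _)
  have hgf : g (i 0) = fun n => (-1) ^ (i 0).val * modSeq f n :=
    funext (hsym.eq_modSeq_compG hg hh (i 0))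
  have hv (y : ℤ → ℝ) : mCoeff g (L + 1) i y
      = (-1 : ℝ) ^ (i 0).val • mCoeff g L (fun t => i t.succ) (fbCoeff (modSeq f) y) := by
    rw [mCoeff, hgf, fbCoeff_const_mul, mCoeff_smul]
  have hw (y : ℤ → ℝ) : mCoeffW g (fun k => compG a b (h k)) (L + 1) (flip0 i) y
      = mCoeff g L (fun t => i t.succ) (fbCoeff f y) := by
    simp [mCoeffW, flip0, f]
  simp only [hv, hw, fbCoeff_modSeq_subSeq]
  refine ⟨rfl, ?_⟩
  rw [fbCoeff_subSeq hf, mCoeff_smul, mCoeff_add hg]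
  simp only [Pi.smul_apply, Pi.add_apply, smul_eq_mul]
  ring
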